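/- Let γ_1 ≥ γ_2 ≥ ⋯ be a nonincreasing sequence of positive reals defining product weights γ_u = ∏_{j∈u} γ_j, and suppose ∑_{j≥1} j·γ_j < ∞. Then for every δ ∈ (0,1) there exists a constant c_δ > 0 (independent of d and N) such that for all dimensions d ≥ 1 and all integers N ≥ 2, the weighted star discrepancy of the first N points of the d-dimensional Halton sequence satisfies D*_{N,γ}(H_{d,N}) ≤ c_δ / N^{1−δ}. -/

import Mathlib

open Finset Real

noncomputable section

/-- Radical inverse function in base `b`: if `n = ∑ nᵢ bⁱ` then `radInv b n = ∑ nᵢ b^{-i-1}`. -/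
def radInv (b n : ℕ) : ℝ := ∑' i : ℕ, (((n / b ^ i) % b : ℕ) : ℝ) / (b : ℝ) ^ (i + 1)

/-- `n`-th point of the `d`-dimensional Halton sequence; coordinate `j` (0-based)
uses the `(j+1)`-st prime (`Nat.nth Nat.Prime 0 = 2`). -/
def halton (d n : ℕ) : Fin d → ℝ := fun j => radInv (Nat.nth Nat.Prime j) n

open scoped Classical in
/-- Star discrepancy of the point set `P` of `N` points with coordinates indexed by `ι`:
`D*_N(P) = sup_{α ∈ [0,1]^ι} |#{n : P n ∈ [0,α)}/N − ∏ᵢ αᵢ|`. -/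
def starDisc {ι : Type} [Fintype ι] (N : ℕ) (P : Fin N → ι → ℝ) : ℝ :=
  sSup {t : ℝ | ∃ α : ι → ℝ, (∀ i, 0 ≤ α i ∧ α i ≤ 1) ∧
    t = |((Finset.univ.filter fun n : Fin N => ∀ i, 0 ≤ P n i ∧ P n i < α i).card : ℝ) / N
          - ∏ i, α i|}

/-- Star discrepancy of the projection of the first `N` points of the `d`-dimensional
Halton sequence onto the coordinates in `u`. -/
def haltonProjStarDisc (d N : ℕ) (u : Finset (Fin d)) : ℝ :=
  starDisc N fun n (i : u) => halton d n i.1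

/-- Weighted star discrepancy, for product weights built from `γ : ℕ → ℝ` (1-based:
coordinate `j : Fin d` carries weight `γ (j+1)`), of the first `N` points of the
`d`-dimensional Halton sequence:
`max_{∅ ≠ u ⊆ [d]} (∏_{j ∈ u} γ_j) · D*_N(H_{d,N}(u))`. -/
def wHaltonStarDisc (γ : ℕ → ℝ) (d N : ℕ) : ℝ :=
  sSup {t : ℝ | ∃ u : Finset (Fin d), u.Nonempty ∧
    t = (∏ j ∈ u, γ (j.1 + 1)) * haltonProjStarDisc d N u}

lemma summable_radInv {b : ℕ} (hb : 2 ≤ b) (n : ℕ) :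
    Summable fun i : ℕ => (((n / b ^ i) % b : ℕ) : ℝ) / (b : ℝ) ^ (i + 1) := by
  refine summable_of_ne_finset_zero (s := range n) fun i hi => ?_
  have h : n < b ^ i := (not_lt.1 (by simpa using hi)).trans_lt (Nat.lt_pow_self (by omega))
  simp [Nat.div_eq_of_lt h]

lemma radInv_nonneg (b n : ℕ) : 0 ≤ radInv b n :=
  tsum_nonneg fun _ => by positivity

lemma radInv_eq {b : ℕ} (hb : 2 ≤ b) (n : ℕ) :
    radInv b n = ((n % b : ℕ) + radInv b (n / b)) / b := by
  rw [radInv, (summable_radInv hb n).tsum_eq_zero_add, add_div, radInv, ← tsum_div_const]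
  congr 1
  · simp
  · refine tsum_congr fun i => ?_
    rw [pow_succ' b i, ← Nat.div_div_eq_div_mul, div_div, ← pow_succ]

lemma radInv_lt_one {b : ℕ} (hb : 2 ≤ b) (n : ℕ) : radInv b n < 1 := by
  induction n using Nat.strong_induction_on with
  | _ n ih =>
    have hb0 : (0 : ℝ) < b := by positivity
    rcases Nat.eq_zero_or_pos n with rfl | hn
    · simp [radInv]
    · have h1 := ih (n / b) (Nat.div_lt_self hn hb)
      have h2 : ((n % b : ℕ) : ℝ) + 1 ≤ b := by
        exact_mod_cast Nat.mod_lt n (by omega)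
      rw [radInv_eq hb, div_lt_one hb0]
      linarith

lemma modEq_add_mul_pow_succ_iff {p a : ℕ} (ha : a < p) (n c k : ℕ) :
    n ≡ a + p * c [MOD p ^ (k + 1)] ↔ n % p = a ∧ n / p ≡ c [MOD p ^ k] := by
  have hp : p ≠ 0 := by omega
  constructor
  · intro h
    have h1 : n % p = a := by
      have h2 : n ≡ a + p * c [MOD p] := h.of_dvd (dvd_pow_self p k.succ_ne_zero)
      rwa [Nat.ModEq, Nat.add_mul_mod_self_left, Nat.mod_eq_of_lt ha] at h2
    refine ⟨h1, Nat.ModEq.mul_left_cancel' hp ?_⟩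
    rw [← pow_succ']
    rw [← Nat.mod_add_div n p, h1] at h
    exact h.add_left_cancel'
  · rintro ⟨h1, h2⟩
    rw [← Nat.mod_add_div n p, h1, pow_succ']
    exact (h2.mul_left' p).add_left a

/-- The indicator of `radInv p n < m / p ^ (r + 1)`, split according to the lowest digit of `n`. -/
lemma indicator_radInv_lt_succ {p : ℕ} (hp : 2 ≤ p) {a m r : ℕ} (hm : m < p ^ r)
    (n : ℕ) :
    (if radInv p n < ((a * p ^ r + m : ℕ) : ℝ) / (p : ℝ) ^ (r + 1) then (1 : ℝ) else 0) =
      (∑ c ∈ range a, if n % p = c then (1 : ℝ) else 0) +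
        if n % p = a then (if radInv p (n / p) < (m : ℝ) / (p : ℝ) ^ r then (1 : ℝ) else 0)
          else 0 := by
  have hp0 : (0 : ℝ) < p := by positivity
  have hpr : (0 : ℝ) < (p : ℝ) ^ r := by positivity
  have hx0 := radInv_nonneg p (n / p)
  have hx1 := radInv_lt_one hp (n / p)
  have hmR : (m : ℝ) / (p : ℝ) ^ r < 1 := by
    rw [div_lt_one hpr]; exact_mod_cast hm
  have hm0 : 0 ≤ (m : ℝ) / (p : ℝ) ^ r := by positivity
  have key : radInv p n < ((a * p ^ r + m : ℕ) : ℝ) / (p : ℝ) ^ (r + 1) ↔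
      ((n % p : ℕ) : ℝ) + radInv p (n / p) < a + (m : ℝ) / (p : ℝ) ^ r := by
    have : ((a * p ^ r + m : ℕ) : ℝ) / (p : ℝ) ^ (r + 1) = (a + (m : ℝ) / (p : ℝ) ^ r) / p := by
      push_cast; field_simp; ring
    rw [this, radInv_eq hp n, div_lt_div_iff_of_pos_right hp0]
  rw [if_congr key rfl rfl, Finset.sum_ite_eq]
  rcases lt_trichotomy (n % p) a with h | h | h
  · have h' : ((n % p : ℕ) : ℝ) + 1 ≤ a := by exact_mod_cast h
    rw [if_pos (by linarith), if_pos (by simpa using h), if_neg h.ne, add_zero]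
  · simp [h]
  · have h' : (a : ℝ) + 1 ≤ (n % p : ℕ) := by exact_mod_cast h
    rw [if_neg (by linarith), if_neg (by simpa using h.le), if_neg h.ne', add_zero]

lemma exists_residue_decomposition_of_lt {p : ℕ} (hp : 2 ≤ p) (r : ℕ) :
    ∀ m < p ^ r, ∃ T : Finset (ℕ × ℕ), #T ≤ r * p ∧ (∀ t ∈ T, 1 ≤ t.1) ∧
      (∀ n, (if radInv p n < (m : ℝ) / (p : ℝ) ^ r then (1 : ℝ) else 0) =
        ∑ t ∈ T, if n ≡ t.2 [MOD p ^ t.1] then (1 : ℝ) else 0) ∧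
      ∑ t ∈ T, (1 : ℝ) / (p : ℝ) ^ t.1 = (m : ℝ) / (p : ℝ) ^ r := by
  have hp0 : (0 : ℝ) < p := by positivity
  induction r with
  | zero =>
    intro m hm
    obtain rfl : m = 0 := by simpa using hm
    exact ⟨∅, by simp, by simp, fun n => by simpa using radInv_nonneg p n, by simp⟩
  | succ r ih =>
    intro m hm
    set a := m / p ^ r with ha_def
    set m' := m % p ^ r with hm'_def
    have hpr : 0 < p ^ r := by positivity
    have ha : a < p := Nat.div_lt_of_lt_mul (by rwa [← pow_succ])
    have hmeq : m = a * p ^ r + m' := by rw [mul_comm]; exact (Nat.div_add_mod m _).symm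
    have hm' : m' < p ^ r := Nat.mod_lt _ hpr
    obtain ⟨T, hcard, hT1, hind, hvol⟩ := ih m' hm'
    have hinj₁ : Set.InjOn (fun c : ℕ => ((1, c) : ℕ × ℕ)) (range a) := by
      intro x _ y _ h; simpa using h
    have hinj₂ : Set.InjOn (fun t : ℕ × ℕ => (t.1 + 1, a + p * t.2)) T := by
      rintro ⟨x₁, x₂⟩ _ ⟨y₁, y₂⟩ _ h
      simp only [Prod.mk.injEq, add_left_inj, add_right_inj] at h
      exact Prod.ext h.1 (Nat.eq_of_mul_eq_mul_left (by omega) h.2)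
    have hdisj : Disjoint ((range a).image fun c : ℕ => ((1, c) : ℕ × ℕ))
        (T.image fun t : ℕ × ℕ => (t.1 + 1, a + p * t.2)) := by
      rw [Finset.disjoint_left]
      intro x hx hy
      obtain ⟨c, _, rfl⟩ := Finset.mem_image.1 hx
      obtain ⟨t, ht, h⟩ := Finset.mem_image.1 hy
      have := hT1 t ht
      simp only [Prod.mk.injEq] at h
      omega
    refine ⟨((range a).image fun c : ℕ => ((1, c) : ℕ × ℕ)) ∪
      T.image fun t : ℕ × ℕ => (t.1 + 1, a + p * t.2), ?_, ?_, fun n => ?_, ?_⟩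
    · refine (Finset.card_union_le _ _).trans ?_
      have h1 : #((range a).image fun c : ℕ => ((1, c) : ℕ × ℕ)) ≤ a := by
        simpa using Finset.card_image_le (s := range a) (f := fun c : ℕ => ((1, c) : ℕ × ℕ))
      have h2 : #(T.image fun t : ℕ × ℕ => (t.1 + 1, a + p * t.2)) ≤ #T := Finset.card_image_le
      linarith
    · intro t ht
      rcases Finset.mem_union.1 ht with h | h
      · obtain ⟨c, _, rfl⟩ := Finset.mem_image.1 h
        exact le_rfl
      · obtain ⟨c, _, rfl⟩ := Finset.mem_image.1 h
        exact Nat.le_add_left _ _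
    · rw [Finset.sum_union hdisj, Finset.sum_image hinj₁, Finset.sum_image hinj₂]
      rw [hmeq, indicator_radInv_lt_succ hp hm', hind]
      congr 1
      · refine Finset.sum_congr rfl fun c hc => ?_
        have hc' : c < p := (Finset.mem_range.1 hc).trans ha
        refine if_congr ?_ rfl rfl
        rw [pow_one, Nat.ModEq, Nat.mod_eq_of_lt hc']
      · simp_rw [modEq_add_mul_pow_succ_iff ha, ite_and]
        by_cases h : n % p = a <;> simp [h]
    · rw [Finset.sum_union hdisj, Finset.sum_image hinj₁, Finset.sum_image hinj₂]
      have h2 : ∑ t ∈ T, (1 : ℝ) / (p : ℝ) ^ (t.1 + 1) = (m' : ℝ) / (p : ℝ) ^ r / p := by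
        rw [← hvol, Finset.sum_div]
        exact Finset.sum_congr rfl fun t _ => by rw [pow_succ, div_div]
      rw [h2, hmeq]
      simp only [pow_one, Finset.sum_const, card_range, nsmul_eq_mul]
      push_cast
      field_simp
      ring

/-- The set of `n` with `radInv p n < m / p ^ r` is a disjoint union of at most `r * p + 1` residue
classes modulo powers of `p`, whose densities add up to `m / p ^ r`. -/
lemma exists_residue_decomposition {p : ℕ} (hp : 2 ≤ p) {r m : ℕ} (hm : m ≤ p ^ r) :
    ∃ T : Finset (ℕ × ℕ), #T ≤ r * p + 1 ∧
      (∀ n, (if radInv p n < (m : ℝ) / (p : ℝ) ^ r then (1 : ℝ) else 0) =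
        ∑ t ∈ T, if n ≡ t.2 [MOD p ^ t.1] then (1 : ℝ) else 0) ∧
      ∑ t ∈ T, (1 : ℝ) / (p : ℝ) ^ t.1 = (m : ℝ) / (p : ℝ) ^ r := by
  rcases hm.lt_or_eq with h | rfl
  · obtain ⟨T, h1, -, h2, h3⟩ := exists_residue_decomposition_of_lt hp r m h
    exact ⟨T, by omega, h2, h3⟩
  · have hpr : (p : ℝ) ^ r ≠ 0 := by positivity
    refine ⟨{(0, 0)}, by simp, fun n => ?_, by simp [div_self hpr]⟩
    rw [Finset.sum_singleton]
    simp [div_self hpr, radInv_lt_one hp n, Nat.modEq_one]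

lemma abs_sum_modEq_sub_le_one {q : ℕ} (hq : 0 < q) (c N : ℕ) :
    |(∑ n ∈ range N, if n ≡ c [MOD q] then (1 : ℝ) else 0) - N * (1 / (q : ℝ))| ≤ 1 := by
  have hqR : (0 : ℝ) < q := by positivity
  rw [Finset.sum_boole, ← Nat.count_eq_card_filter_range, Nat.count_modEq_card N hq]
  have h1 : (N : ℝ) * (1 / (q : ℝ)) = (N / q : ℕ) + (N % q : ℕ) / (q : ℝ) := by
    have : (N : ℝ) = q * (N / q : ℕ) + (N % q : ℕ) := by exact_mod_cast (Nat.div_add_mod N q).symm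
    rw [mul_one_div]
    nth_rewrite 1 [this]
    field_simp
  have h2 : ((N % q : ℕ) : ℝ) / q ≤ 1 := by
    rw [div_le_one hqR]; exact_mod_cast (Nat.mod_lt N hq).le
  have h3 : (0 : ℝ) ≤ ((N % q : ℕ) : ℝ) / q := by positivity
  rw [h1, abs_le]
  push_cast
  split_ifs <;> constructor <;> norm_num <;> linarith

lemma exists_forall_modEq_iff {ι : Type*} [Fintype ι] (q c : ι → ℕ) (hq : ∀ i, q i ≠ 0)
    (hco : Pairwise (Function.onFun Nat.Coprime q)) :
    ∃ k, ∀ n, (∀ i, n ≡ c i [MOD q i]) ↔ n ≡ k [MOD ∏ i, q i] := by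
  obtain ⟨k, hk⟩ := Nat.chineseRemainderOfFinset c q Finset.univ (fun i _ => hq i)
    (hco.set_pairwise _)
  refine ⟨k, fun n => ⟨fun h => ?_, fun h i => ?_⟩⟩
  · rw [Nat.modEq_iff_dvd, Nat.cast_prod]
    refine Fintype.prod_dvd_of_coprime (fun i j hij => Nat.isCoprime_iff_coprime.2 (hco hij))
      fun i => ?_
    exact Nat.modEq_iff_dvd.1 ((h i).trans (hk i (Finset.mem_univ i)).symm)
  · exact (h.of_dvd (Finset.dvd_prod_of_mem q (Finset.mem_univ i))).trans
      (hk i (Finset.mem_univ i))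

lemma abs_sum_prod_modEq_sub_le_one {ι : Type*} [Fintype ι] (q c : ι → ℕ) (hq : ∀ i, q i ≠ 0)
    (hco : Pairwise (Function.onFun Nat.Coprime q)) (N : ℕ) :
    |(∑ n ∈ range N, ∏ i, if n ≡ c i [MOD q i] then (1 : ℝ) else 0) - N * ∏ i, 1 / (q i : ℝ)|
      ≤ 1 := by
  obtain ⟨k, hk⟩ := exists_forall_modEq_iff q c hq hco
  have h := abs_sum_modEq_sub_le_one (Nat.pos_of_ne_zero (Finset.prod_ne_zero_iff.2
    fun i (_ : i ∈ Finset.univ) => hq i)) k N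
  simp_rw [Fintype.prod_boole, hk]
  rwa [Nat.cast_prod, ← Finset.prod_const_one, ← Finset.prod_div_distrib,
    Finset.prod_const_one] at h

/-- Discrepancy estimate for boxes whose side lengths are `p i`-adic rationals. -/
lemma abs_sum_prod_radInv_lt_sub_le {ι : Type*} [Fintype ι] (p : ι → ℕ) (hp : ∀ i, (p i).Prime)
    (hinj : Function.Injective p) (r m : ι → ℕ) (hm : ∀ i, m i ≤ p i ^ r i) (N : ℕ) :
    |(∑ n ∈ range N, ∏ i, if radInv (p i) n < (m i : ℝ) / (p i : ℝ) ^ r i then (1 : ℝ) else 0)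
      - N * ∏ i, (m i : ℝ) / (p i : ℝ) ^ r i| ≤ ∏ i, ((r i : ℝ) * p i + 1) := by
  classical
  choose T hcard hind hvol using fun i => exists_residue_decomposition (hp i).two_le (hm i)
  simp_rw [hind, ← hvol, Finset.prod_univ_sum]
  rw [Finset.sum_comm, Finset.mul_sum, ← Finset.sum_sub_distrib]
  refine (Finset.abs_sum_le_sum_abs _ _).trans ?_
  calc _ ≤ ∑ t ∈ Fintype.piFinset T, (1 : ℝ) := by
        refine Finset.sum_le_sum fun t _ => ?_
        simpa only [Nat.cast_pow] using abs_sum_prod_modEq_sub_le_one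
          (fun i => p i ^ (t i).1) (fun i => (t i).2) (fun i => pow_ne_zero _ (hp i).ne_zero)
          (fun i j hij => Nat.coprime_pow_primes _ _ (hp i) (hp j) (hinj.ne hij)) N
    _ = ∏ i, (#(T i) : ℝ) := by simp
    _ ≤ _ := Finset.prod_le_prod (fun i _ => by positivity) fun i _ => by exact_mod_cast hcard i

lemma prod_sub_prod_le_sum {ι : Type*} (s : Finset ι) (x y : ι → ℝ) (hy : ∀ i ∈ s, 0 ≤ y i)
    (hyx : ∀ i ∈ s, y i ≤ x i) (hx : ∀ i ∈ s, x i ≤ 1) :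
    ∏ i ∈ s, x i - ∏ i ∈ s, y i ≤ ∑ i ∈ s, (x i - y i) := by
  classical
  induction s using Finset.induction_on with
  | empty => simp
  | insert a s ha ih =>
    simp only [Finset.mem_insert, forall_eq_or_imp] at hy hyx hx
    have h1 := ih hy.2 hyx.2 hx.2
    have h2 : 0 ≤ ∏ i ∈ s, y i := Finset.prod_nonneg hy.2
    have h3 : ∏ i ∈ s, y i ≤ ∏ i ∈ s, x i := Finset.prod_le_prod hy.2 hyx.2
    have h4 : ∏ i ∈ s, x i ≤ 1 :=
      Finset.prod_le_one (fun i hi => (hy.2 i hi).trans (hyx.2 i hi)) hx.2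
    rw [Finset.prod_insert ha, Finset.prod_insert ha, Finset.sum_insert ha]
    nlinarith [mul_nonneg (sub_nonneg.2 hx.1) (sub_nonneg.2 h3),
      mul_nonneg (sub_nonneg.2 hyx.1) (sub_nonneg.2 (h3.trans h4))]

lemma abs_sum_prod_radInv_lt_sub_le_of_mem_Icc {ι : Type*} [Fintype ι] (p : ι → ℕ)
    (hp : ∀ i, (p i).Prime) (hinj : Function.Injective p) (r : ι → ℕ) {N : ℕ}
    (hr : ∀ i, N ≤ p i ^ r i) (α : ι → ℝ) (hα : ∀ i, 0 ≤ α i ∧ α i ≤ 1) :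
    |(∑ n ∈ range N, ∏ i, if radInv (p i) n < α i then (1 : ℝ) else 0) - N * ∏ i, α i|
      ≤ ∏ i, ((r i : ℝ) * p i + 1) + Fintype.card ι := by
  have hq (i) : (0 : ℝ) < (p i : ℝ) ^ r i := by
    have : (0 : ℝ) < p i := by exact_mod_cast (hp i).pos
    positivity
  let l : ι → ℕ := fun i => ⌊α i * (p i : ℝ) ^ r i⌋₊
  let u : ι → ℕ := fun i => ⌈α i * (p i : ℝ) ^ r i⌉₊
  have hαq (i) : α i * (p i : ℝ) ^ r i ≤ ((p i ^ r i : ℕ) : ℝ) := by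
    push_cast; exact mul_le_of_le_one_left (hq i).le (hα i).2
  have hu (i) : u i ≤ p i ^ r i := Nat.ceil_le.2 (hαq i)
  have hl (i) : l i ≤ p i ^ r i := (Nat.floor_le_ceil _).trans (hu i)
  have hlα (i) : (l i : ℝ) / (p i : ℝ) ^ r i ≤ α i := by
    rw [div_le_iff₀ (hq i)]; exact Nat.floor_le (mul_nonneg (hα i).1 (hq i).le)
  have hαu (i) : α i ≤ (u i : ℝ) / (p i : ℝ) ^ r i := by
    rw [le_div_iff₀ (hq i)]; exact Nat.le_ceil _
  have hu1 (i) : (u i : ℝ) / (p i : ℝ) ^ r i ≤ 1 := by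
    rw [div_le_one (hq i)]; exact_mod_cast hu i
  have hl0 (i) : 0 ≤ (l i : ℝ) / (p i : ℝ) ^ r i := by have := hq i; positivity
  have hN (i) : (N : ℝ) * (1 / (p i : ℝ) ^ r i) ≤ 1 := by
    rw [mul_one_div, div_le_one (hq i)]; exact_mod_cast hr i
  have hNα : (0 : ℝ) ≤ N := Nat.cast_nonneg N
  have gap_l (i) : N * (α i - (l i : ℝ) / (p i : ℝ) ^ r i) ≤ 1 := by
    refine (mul_le_mul_of_nonneg_left ?_ hNα).trans (hN i)
    rw [sub_le_iff_le_add, ← add_div, le_div_iff₀ (hq i), add_comm]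
    exact (Nat.lt_floor_add_one _).le
  have gap_u (i) : N * ((u i : ℝ) / (p i : ℝ) ^ r i - α i) ≤ 1 := by
    refine (mul_le_mul_of_nonneg_left ?_ hNα).trans (hN i)
    rw [sub_le_iff_le_add, div_le_iff₀ (hq i), add_mul, one_div_mul_cancel (hq i).ne', add_comm]
    exact (Nat.ceil_lt_add_one (mul_nonneg (hα i).1 (hq i).le)).le
  have mono (x y : ι → ℝ) (h : ∀ i, x i ≤ y i) :
      (∑ n ∈ range N, ∏ i, if radInv (p i) n < x i then (1 : ℝ) else 0) ≤
        ∑ n ∈ range N, ∏ i, if radInv (p i) n < y i then (1 : ℝ) else 0 := by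
    refine Finset.sum_le_sum fun n _ => Finset.prod_le_prod (fun i _ => by split_ifs <;> norm_num)
      fun i _ => ?_
    split_ifs with h1 h2
    · exact le_rfl
    · exact absurd (h1.trans_le (h i)) h2
    · exact zero_le_one
    · exact le_rfl
  have vol (x y : ι → ℝ) (hx : ∀ i, 0 ≤ x i) (hxy : ∀ i, x i ≤ y i) (hy : ∀ i, y i ≤ 1)
      (hgap : ∀ i, N * (y i - x i) ≤ 1) : N * ∏ i, y i - N * ∏ i, x i ≤ Fintype.card ι := by
    rw [← mul_sub]
    refine (mul_le_mul_of_nonneg_left (prod_sub_prod_le_sum Finset.univ y x (fun i _ => hx i)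
      (fun i _ => hxy i) fun i _ => hy i) hNα).trans ?_
    rw [Finset.mul_sum]
    exact (Finset.sum_le_sum fun i _ => hgap i).trans (by simp)
  have h1 := abs_le.1 (abs_sum_prod_radInv_lt_sub_le p hp hinj r l hl N)
  have h2 := abs_le.1 (abs_sum_prod_radInv_lt_sub_le p hp hinj r u hu N)
  have h3 := mono _ _ hlα
  have h4 := mono _ _ hαu
  have h5 := vol _ _ hl0 hlα (fun i => (hα i).2) gap_l
  have h6 := vol _ _ (fun i => (hα i).1) hαu hu1 gap_u
  rw [abs_le]
  constructor <;> linarith [h1.1, h2.2]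

lemma card_filter_radInv_eq_sum {ι : Type*} [Fintype ι] (p : ι → ℕ) (α : ι → ℝ) (N : ℕ)
    [DecidablePred fun n : Fin N => ∀ i, 0 ≤ radInv (p i) n ∧ radInv (p i) n < α i] :
    (#{n : Fin N | ∀ i, 0 ≤ radInv (p i) n ∧ radInv (p i) n < α i} : ℝ) =
      ∑ n ∈ range N, ∏ i, if radInv (p i) n < α i then (1 : ℝ) else 0 := by
  classical
  rw [← Fin.sum_univ_eq_sum_range (fun n => ∏ i, if radInv (p i) n < α i then (1 : ℝ) else 0),
    Finset.card_filter, Nat.cast_sum]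
  refine Finset.sum_congr rfl fun n _ => ?_
  rw [Fintype.prod_boole, Nat.cast_ite, Nat.cast_one, Nat.cast_zero]
  exact if_congr (by simp [radInv_nonneg]) rfl rfl

lemma starDisc_le_one {ι : Type} [Fintype ι] (N : ℕ) (P : Fin N → ι → ℝ) :
    starDisc N P ≤ 1 := by
  classical
  refine Real.sSup_le ?_ zero_le_one
  rintro t ⟨α, hα, rfl⟩
  have h1 : ∏ i, α i ≤ 1 := Finset.prod_le_one (fun i _ => (hα i).1) fun i _ => (hα i).2
  have h0 : 0 ≤ ∏ i, α i := Finset.prod_nonneg fun i _ => (hα i).1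
  refine abs_sub_le_of_le_of_le (by positivity) (div_le_one_of_le₀ ?_ (Nat.cast_nonneg N)) h0 h1
    |>.trans_eq (sub_zero 1)
  exact_mod_cast (Finset.card_filter_le _ _).trans_eq (by simp)

lemma starDisc_radInv_le {ι : Type} [Fintype ι] (p : ι → ℕ) (hp : ∀ i, (p i).Prime)
    (hinj : Function.Injective p) (r : ι → ℕ) {N : ℕ} (hN : 0 < N) (hr : ∀ i, N ≤ p i ^ r i) :
    starDisc N (fun n i => radInv (p i) n) ≤
      (∏ i, ((r i : ℝ) * p i + 1) + Fintype.card ι) / N := by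
  have hNR : (0 : ℝ) < N := by exact_mod_cast hN
  refine Real.sSup_le ?_ (by positivity)
  rintro t ⟨α, hα, rfl⟩
  rw [card_filter_radInv_eq_sum, le_div_iff₀ hNR, ← abs_of_pos hNR, ← abs_mul, abs_of_pos hNR,
    sub_mul, div_mul_cancel₀ _ hNR.ne', mul_comm (∏ i, α i)]
  exact abs_sum_prod_radInv_lt_sub_le_of_mem_Icc p hp hinj r hr α hα

lemma nth_prime_le_mul_log (j : ℕ) :
    (Nat.nth Nat.Prime j : ℝ) ≤ 6 * (j + 1) * log (Nat.nth Nat.Prime j) := by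
  set p := Nat.nth Nat.Prime j with hp
  have hprime : p.Prime := Nat.prime_nth_prime j
  have h2 : (2 : ℝ) ≤ p := by exact_mod_cast hprime.two_le
  have hlog : 0 < log p := log_pos (by linarith)
  have hpi : Nat.primeCounting p = j + 1 := by
    rw [Nat.primeCounting, Nat.primeCounting', Nat.count_succ, hp, Nat.count_nth_of_infinite
      Nat.infinite_setOfPred_prime, if_pos (Nat.prime_nth_prime j)]
  have h := Chebyshev.pi_ge p
  rw [hpi, div_le_iff₀ hlog] at h
  push_cast at h
  have h3 : log ((p : ℝ) + 1) ≤ 2 * log p := by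
    rw [← log_rpow (by linarith)]
    exact log_le_log (by linarith) (by norm_num; nlinarith)
  have hj : (0 : ℝ) ≤ j * log p := by positivity
  nlinarith [log_two_gt_d9]

lemma nth_prime_le_mul_sq (j : ℕ) :
    (Nat.nth Nat.Prime j : ℝ) ≤ 144 * ((j : ℝ) + 1) ^ 2 := by
  set p := Nat.nth Nat.Prime j with hp
  have h := nth_prime_le_mul_log j
  rw [← hp] at h
  have hp0 : (0 : ℝ) < p := by exact_mod_cast (Nat.prime_nth_prime j).pos
  have hs : 0 < √(p : ℝ) := sqrt_pos.2 hp0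
  have hsq : √(p : ℝ) * √p = p := mul_self_sqrt hp0.le
  have h1 : log (p : ℝ) ≤ 2 * √p := by
    have := log_le_sub_one_of_pos hs
    rw [log_sqrt hp0.le] at this
    linarith
  have h2 : √(p : ℝ) ≤ 12 * (j + 1) := by
    have h3 : √(p : ℝ) * √p ≤ 12 * (j + 1) * √p := by
      rw [hsq]
      calc (p : ℝ) ≤ 6 * (j + 1) * log p := h
        _ ≤ 6 * (j + 1) * (2 * √p) := by gcongr
        _ = _ := by ring
    exact le_of_mul_le_mul_right h3 hs
  rw [← hsq]
  nlinarith

/-- If `∑ aⱼ < ∞` then `∏ (1 + aⱼ L)` grows subexponentially in `L`. -/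
lemma exists_prod_one_add_mul_le_exp {a : ℕ → ℝ} (ha : ∀ j, 0 ≤ a j) (hs : Summable a) {δ : ℝ}
    (hδ : 0 < δ) :
    ∃ K : ℝ, 0 < K ∧ ∀ s : Finset ℕ, ∀ L : ℝ, 0 ≤ L → ∏ j ∈ s, (1 + a j * L) ≤ K * exp (δ * L) := by
  obtain ⟨F, hF⟩ := summable_iff_vanishing_norm.1 hs (δ / 2) (by positivity)
  set ε := δ / (2 * (#F + 1)) with hε
  have hε0 : 0 < ε := by positivity
  refine ⟨∏ j ∈ F, (1 + a j / ε), Finset.prod_pos fun j _ => by have := ha j; positivity,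
    fun s L hL => ?_⟩
  rw [← Finset.prod_inter_mul_prod_sdiff s F]
  have hfac (j : ℕ) : 1 ≤ 1 + a j * L := by have := mul_nonneg (ha j) hL; linarith
  have h1 : ∏ j ∈ s ∩ F, (1 + a j * L) ≤ (∏ j ∈ F, (1 + a j / ε)) * exp (δ / 2 * L) := by
    calc ∏ j ∈ s ∩ F, (1 + a j * L) ≤ ∏ j ∈ F, (1 + a j * L) :=
          Finset.prod_le_prod_of_subset_of_one_le Finset.inter_subset_right
            (fun j _ => zero_le_one.trans (hfac j)) fun j _ _ => hfac j
      _ ≤ ∏ j ∈ F, ((1 + a j / ε) * exp (ε * L)) := by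
          refine Finset.prod_le_prod (fun j _ => zero_le_one.trans (hfac j)) fun j _ => ?_
          have h2 : a j * L = a j / ε * (ε * L) := by field_simp
          have h3 : 0 ≤ ε * L := by positivity
          have h4 : 0 ≤ a j / ε := by have := ha j; positivity
          have h5 := add_one_le_exp (ε * L)
          rw [h2]
          nlinarith [mul_le_mul_of_nonneg_left h5 h4]
      _ = (∏ j ∈ F, (1 + a j / ε)) * exp (#F * (ε * L)) := by
          rw [Finset.prod_mul_distrib, Finset.prod_const, exp_nat_mul]
      _ ≤ _ := by
          have h6 : #F * ε ≤ δ / 2 := by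
            rw [hε]
            field_simp
            linarith
          have : 0 ≤ ∏ j ∈ F, (1 + a j / ε) :=
            Finset.prod_nonneg fun j _ => by have := ha j; positivity
          rw [← mul_assoc]
          gcongr
  have h2 : ∏ j ∈ s \ F, (1 + a j * L) ≤ exp (δ / 2 * L) := by
    calc ∏ j ∈ s \ F, (1 + a j * L) ≤ ∏ j ∈ s \ F, exp (a j * L) :=
          Finset.prod_le_prod (fun j _ => zero_le_one.trans (hfac j)) fun j _ => by
            linarith [add_one_le_exp (a j * L)]
      _ = exp ((∑ j ∈ s \ F, a j) * L) := by rw [← exp_sum, Finset.sum_mul]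
      _ ≤ _ := by
          have := (le_abs_self _).trans (hF (s \ F) Finset.sdiff_disjoint).le
          gcongr
  calc _ ≤ (∏ j ∈ F, (1 + a j / ε)) * exp (δ / 2 * L) * exp (δ / 2 * L) := by
        refine mul_le_mul h1 h2 (Finset.prod_nonneg fun j _ => zero_le_one.trans (hfac j)) ?_
        exact (Finset.prod_nonneg fun j _ => zero_le_one.trans (hfac j)).trans h1
    _ = _ := by rw [mul_assoc, ← exp_add, ← add_mul, add_halves]

/-- A nonincreasing sequence with `∑ j * γ j < ∞` satisfies `γ j = O(1 / j ^ 2)`. -/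
lemma mul_sq_le_two_mul_tsum {γ : ℕ → ℝ} (hpos : ∀ j : ℕ, 1 ≤ j → 0 < γ j)
    (hmono : ∀ j : ℕ, 1 ≤ j → γ (j + 1) ≤ γ j) (hsum : Summable fun j : ℕ => (j : ℝ) * γ j)
    {j : ℕ} (hj : 1 ≤ j) : γ j * (j : ℝ) ^ 2 ≤ 2 * ∑' i : ℕ, (i : ℝ) * γ i := by
  have hnonneg (i : ℕ) : 0 ≤ (i : ℝ) * γ i := by
    rcases Nat.eq_zero_or_pos i with rfl | hi
    · simp
    · have := hpos i hi; positivity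
  have hanti (i : ℕ) (hi : 1 ≤ i) (hij : i ≤ j) : γ j ≤ γ i := by
    induction j, hij using Nat.le_induction with
    | base => exact le_rfl
    | succ k hk ih => exact (hmono k (hi.trans hk)).trans (ih (hi.trans hk))
  have h1 : ∑ i ∈ range (j + 1), (i : ℝ) * γ j ≤ ∑' i : ℕ, (i : ℝ) * γ i := by
    refine (Finset.sum_le_sum fun i hi => ?_).trans
      (hsum.sum_le_tsum (range (j + 1)) fun i _ => hnonneg i)
    rcases Nat.eq_zero_or_pos i with rfl | hi0
    · simp
    · exact mul_le_mul_of_nonneg_left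
        (hanti i hi0 (Nat.lt_succ_iff.1 (Finset.mem_range.1 hi))) (Nat.cast_nonneg i)
  have h2 : (∑ i ∈ range (j + 1), (i : ℝ)) * 2 = (j + 1) * j := by
    have h := congrArg (Nat.cast (R := ℝ)) (Finset.sum_range_id_mul_two (j + 1))
    rw [add_tsub_cancel_right] at h
    push_cast at h
    exact h
  rw [← Finset.sum_mul] at h1
  have h3 := (hpos j hj).le
  nlinarith [mul_nonneg h3 (Nat.cast_nonneg (α := ℝ) j)]

lemma clog_mul_add_one_le {j N : ℕ} (hN : 2 ≤ N) (hj : Nat.nth Nat.Prime j ≤ N) :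
    ((Nat.clog (Nat.nth Nat.Prime j) N : ℕ) : ℝ) * (Nat.nth Nat.Prime j : ℕ) + 1 ≤
      24 * (j + 1) * log N := by
  have hle := nth_prime_le_mul_log j
  have hprime := Nat.prime_nth_prime j
  set p := Nat.nth Nat.Prime j
  have hp2 : (2 : ℝ) ≤ p := by exact_mod_cast hprime.two_le
  have hlog : 0 < log p := log_pos (by linarith)
  have hlogle : log p ≤ log N := log_le_log (by linarith) (by exact_mod_cast hj)
  have hclog : 0 < Nat.clog p N := Nat.clog_pos hprime.one_lt hN
  obtain ⟨k, hk⟩ : ∃ k, Nat.clog p N = k + 1 := ⟨_, (Nat.succ_pred_eq_of_pos hclog).symm⟩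
  have hlt : p ^ k < N := by
    have := Nat.pow_pred_clog_lt_self hprime.one_lt hN
    rwa [hk] at this
  have hkl : k * log p ≤ log N := by
    rw [← log_pow]
    exact log_le_log (by positivity) (by exact_mod_cast hlt.le)
  rw [hk]
  push_cast
  have hk0 : (0 : ℝ) ≤ k := Nat.cast_nonneg k
  calc ((k : ℝ) + 1) * p + 1 ≤ 2 * (k + 1) * p := by nlinarith
    _ ≤ 2 * (k + 1) * (6 * (j + 1) * log p) := by gcongr
    _ = 12 * (j + 1) * (k * log p + log p) := by ring
    _ ≤ 12 * (j + 1) * (log N + log N) := by gcongr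
    _ = _ := by ring

lemma haltonProjStarDisc_le {d N : ℕ} (hN : 2 ≤ N) (u : Finset (Fin d))
    (hu : ∀ j ∈ u, Nat.nth Nat.Prime j ≤ N) :
    haltonProjStarDisc d N u ≤ 2 / N * ∏ j ∈ u, (24 * ((j : ℝ) + 1) * log N) := by
  have hinj : Function.Injective fun i : u => Nat.nth Nat.Prime i.1 := fun i j h =>
    Subtype.ext (Fin.ext (Nat.nth_injective Nat.infinite_setOfPred_prime h))
  have hprime (i : u) : (Nat.nth Nat.Prime i.1).Prime := Nat.prime_nth_prime _
  refine (starDisc_radInv_le (fun i : u => Nat.nth Nat.Prime i.1) hprime hinj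
    (fun i => Nat.clog (Nat.nth Nat.Prime i.1) N) (by omega)
    fun i => Nat.le_pow_clog (hprime i).one_lt N).trans ?_
  have hfac (i : u) : (2 : ℝ) ≤
      (Nat.clog (Nat.nth Nat.Prime i.1) N : ℕ) * (Nat.nth Nat.Prime i.1 : ℕ) + 1 := by
    have h : 1 ≤ Nat.clog (Nat.nth Nat.Prime i.1) N * Nat.nth Nat.Prime i.1 :=
      Nat.mul_pos (Nat.clog_pos (hprime i).one_lt hN) (hprime i).pos
    have h' : (1 : ℝ) ≤ (Nat.clog (Nat.nth Nat.Prime i.1) N : ℕ) * (Nat.nth Nat.Prime i.1 : ℕ) := by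
      exact_mod_cast h
    linarith
  have hcard : (Fintype.card u : ℝ) ≤ ∏ i : u,
      (((Nat.clog (Nat.nth Nat.Prime i.1) N : ℕ) : ℝ) * (Nat.nth Nat.Prime i.1 : ℕ) + 1) := by
    calc (Fintype.card u : ℝ) ≤ 2 ^ Fintype.card u := by exact_mod_cast Nat.lt_two_pow_self.le
      _ = ∏ _i : u, (2 : ℝ) := by simp
      _ ≤ _ := Finset.prod_le_prod (fun _ _ => zero_le_two) fun i _ => hfac i
  have hprod : ∏ i : u,
      (((Nat.clog (Nat.nth Nat.Prime i.1) N : ℕ) : ℝ) * (Nat.nth Nat.Prime i.1 : ℕ) + 1) ≤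
        ∏ j ∈ u, (24 * ((j : ℝ) + 1) * log N) := by
    rw [← Finset.prod_coe_sort u]
    exact Finset.prod_le_prod (fun i _ => zero_le_two.trans (hfac i)) fun i _ =>
      clog_mul_add_one_le hN (hu i i.2)
  rw [div_mul_eq_mul_div]
  gcongr
  linarith

/-- If `∑_{j≥1} j·γ_j < ∞`, then for every `δ ∈ (0,1)` there is `c_δ > 0` with
`D*_{N,γ}(H_{d,N}) ≤ c_δ / N^{1−δ}` for all `d ≥ 1` and `N ≥ 2`. -/
theorem halton_weighted_star_disc_bound
    (γ : ℕ → ℝ) (hpos : ∀ j : ℕ, 1 ≤ j → 0 < γ j)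
    (hmono : ∀ j : ℕ, 1 ≤ j → γ (j + 1) ≤ γ j)
    (hsum : Summable fun j : ℕ => (j : ℝ) * γ j) :
    ∀ δ : ℝ, 0 < δ → δ < 1 → ∃ c : ℝ, 0 < c ∧
      ∀ d : ℕ, 1 ≤ d → ∀ N : ℕ, 2 ≤ N →
        wHaltonStarDisc γ d N ≤ c / (N : ℝ) ^ (1 - δ) := by
  intro δ hδ _
  set S := ∑' i : ℕ, (i : ℝ) * γ i with hS
  have hγ (j : ℕ) : 0 < γ (j + 1) := hpos (j + 1) (Nat.le_add_left 1 j)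
  have ha (j : ℕ) : 0 ≤ 24 * ((j : ℝ) + 1) * γ (j + 1) := by have := hγ j; positivity
  have hs : Summable fun j : ℕ => 24 * ((j : ℝ) + 1) * γ (j + 1) := by
    simpa [mul_assoc] using ((summable_nat_add_iff 1).2 hsum).mul_left 24
  have hS0 : 0 ≤ S := by
    have := mul_sq_le_two_mul_tsum hpos hmono hsum le_rfl
    have := hpos 1 le_rfl
    norm_num at *
    linarith
  obtain ⟨K, hK, hprod⟩ := exists_prod_one_add_mul_le_exp ha hs hδ
  have hprodFin {d : ℕ} (u : Finset (Fin d)) {L : ℝ} (hL : 0 ≤ L) :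
      ∏ j ∈ u, (1 + 24 * ((j : ℝ) + 1) * γ (j + 1) * L) ≤ K * exp (δ * L) := by
    simpa using hprod (u.map Fin.valEmbedding) L hL
  refine ⟨2 * K + 288 * S * (K * exp δ), by positivity, fun d _ N hN => ?_⟩
  have hNR : (0 : ℝ) < N := by positivity
  have hN1 : (1 : ℝ) ≤ N := by exact_mod_cast (by omega : 1 ≤ N)
  have hNδ : 1 ≤ (N : ℝ) ^ δ := one_le_rpow hN1 hδ.le
  refine Real.sSup_le ?_ (by positivity)
  rintro t ⟨u, -, rfl⟩
  have hw : 0 ≤ ∏ j ∈ u, γ (j.1 + 1) := Finset.prod_nonneg fun j _ => (hγ j).le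
  rw [rpow_sub hNR, rpow_one, div_div_eq_mul_div, le_div_iff₀ hNR]
  by_cases hu : ∀ j ∈ u, Nat.nth Nat.Prime j ≤ N
  · have hlog : 0 ≤ log (N : ℝ) := log_nonneg hN1
    calc (∏ j ∈ u, γ (j.1 + 1)) * haltonProjStarDisc d N u * N
        ≤ (∏ j ∈ u, γ (j.1 + 1)) *
            (2 / N * ∏ j ∈ u, (24 * ((j : ℝ) + 1) * log N)) * N := by
          gcongr
          exact haltonProjStarDisc_le hN u hu
      _ = 2 * ∏ j ∈ u, (24 * ((j : ℝ) + 1) * γ (j + 1) * log N) := by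
          have : ∏ j ∈ u, (24 * ((j : ℝ) + 1) * γ (j + 1) * log N) =
              (∏ j ∈ u, γ (j.1 + 1)) * ∏ j ∈ u, (24 * ((j : ℝ) + 1) * log N) := by
            rw [← Finset.prod_mul_distrib]
            exact Finset.prod_congr rfl fun j _ => by ring
          rw [this]
          generalize ∏ j ∈ u, (24 * ((j : ℝ) + 1) * log N) = Q
          field_simp
      _ ≤ 2 * ∏ j ∈ u, (1 + 24 * ((j : ℝ) + 1) * γ (j + 1) * log N) := by
          gcongr with j
          · intro j _
            exact mul_nonneg (ha j) hlog
          · linarith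
      _ ≤ 2 * (K * exp (δ * log N)) := by
          gcongr
          exact hprodFin u hlog
      _ = 2 * K * (N : ℝ) ^ δ := by rw [rpow_def_of_pos hNR, mul_comm δ, mul_assoc]
      _ ≤ _ := by
          gcongr
          exact le_add_of_nonneg_right (by positivity)
  · push Not at hu
    obtain ⟨j, hj, hNj⟩ := hu
    have hjN : γ (j.1 + 1) * N ≤ 288 * S := by
      have h1 := mul_sq_le_two_mul_tsum hpos hmono hsum (Nat.le_add_left 1 j.1)
      have h2 : (N : ℝ) ≤ 144 * ((j.1 : ℝ) + 1) ^ 2 :=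
        le_trans (by exact_mod_cast hNj.le) (nth_prime_le_mul_sq j)
      push_cast at h1
      nlinarith [mul_le_mul_of_nonneg_left h2 (hγ j).le]
    have hrest : ∏ i ∈ u.erase j, γ (i.1 + 1) ≤ K * exp δ := by
      have h := hprodFin (u.erase j) zero_le_one
      rw [mul_one] at h
      refine le_trans (Finset.prod_le_prod (fun i _ => (hγ i.1).le) fun i _ => ?_) h
      have := hγ i
      have : 0 ≤ (i.1 : ℝ) * γ (i + 1) := by positivity
      nlinarith
    calc (∏ j ∈ u, γ (j.1 + 1)) * haltonProjStarDisc d N u * N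
        ≤ (∏ j ∈ u, γ (j.1 + 1)) * 1 * N := by
          gcongr
          exact starDisc_le_one N _
      _ = γ (j.1 + 1) * N * ∏ i ∈ u.erase j, γ (i.1 + 1) := by
          rw [← Finset.mul_prod_erase u _ hj]
          ring
      _ ≤ 288 * S * (K * exp δ) := by
          gcongr
          exact Finset.prod_nonneg fun i _ => (hγ i).le
      _ ≤ (2 * K + 288 * S * (K * exp δ)) * 1 := by linarith
      _ ≤ _ := by gcongr
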